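/- arXiv:2504.20027 — 6 statements merged into one kernel-verified Lean document; each statement's English description precedes it below -/
import Mathlib

section
/- There is an absolute constant d such that the following holds for every digraph G and every positive integer k. Let 𝒮 be the family of all subsets C ⊆ V(G) such that for some F ⊆ V(G) with |F| ≤ k, either C is a strongly connected component of G∖F, or C is the union of all strongly connected components of G∖F except one. Then every set W ⊆ V(G) shattered by 𝒮 satisfies |W| ≤ d·k; that is, the VC-dimension of 𝒮 is at most d·k. -/
/-- `u` reaches `v` in `G∖F` by a directed path avoiding `F`. -/
def ReachAvoid {V : Type*} (E : V → V → Prop) (F : Finset V) (u v : V) : Prop :=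
  u ∉ F ∧ Relation.ReflTransGen (fun a b => E a b ∧ b ∉ F) u v

/-- `C` is a strongly connected component of `G∖F` (an equivalence class of
mutual reachability in `G∖F`). -/
def IsSCC {V : Type*} (E : V → V → Prop) (F : Finset V) (C : Set V) : Prop :=
  ∃ u, u ∉ F ∧ C = {v | ReachAvoid E F u v ∧ ReachAvoid E F v u}

/-- The family of all sets `C ⊆ V(G)` such that for some `F` with `|F| ≤ k`, `C` is an
SCC of `G∖F` or the union of all SCCs of `G∖F` except one. -/
def SCCFamily {V : Type*} (E : V → V → Prop) (k : ℕ) : Set (Set V) :=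
  {C | ∃ F : Finset V, F.card ≤ k ∧
    (IsSCC E F C ∨ ∃ C₀ : Set V, IsSCC E F C₀ ∧ C = {v : V | v ∉ F} \ C₀)}

open Finset

section Submodular

variable {V : Type*}

/-- Every set that contains `A` and avoids `T` has `d`-value at least `m`. -/
def CutBound (d : Finset V → ℕ) (m : ℕ) (A T : Finset V) : Prop :=
  ∀ R, A ⊆ R → Disjoint R T → m ≤ d R

theorem CutBound.mono {d : Finset V → ℕ} {m : ℕ} {A A' T T' : Finset V}
    (h : CutBound d m A T) (hA : A ⊆ A') (hT : T ⊆ T') : CutBound d m A' T' :=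
  fun R hR hd => h R (hA.trans hR) (hd.mono_right hT)

variable [DecidableEq V]

/-- If the whole of `T` forces a larger cut than `S`, a single element of `T` does. -/
theorem CutBound.exists_augment [Fintype V] {d : Finset V → ℕ}
    (hsub : ∀ R S, d (R ∩ S) + d (R ∪ S) ≤ d R + d S) {m : ℕ} {A S T : Finset V}
    (hS : CutBound d m A S) (hT : CutBound d (m + 1) A T) :
    ∃ X ⊆ T, X.card ≤ 1 ∧ CutBound d (m + 1) A (S ∪ X) := by
  by_cases h : ∃ R, A ⊆ R ∧ Disjoint R S ∧ d R ≤ m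
  · obtain ⟨R₀, hR₀⟩ := h
    obtain ⟨R, -, hR⟩ := Finite.exists_le_minimal
      (p := fun R => A ⊆ R ∧ Disjoint R S ∧ d R ≤ m) hR₀
    obtain ⟨⟨hAR, hRS, hdR⟩, hmin⟩ := hR
    have hnd : ¬ Disjoint R T := fun hRT => by
      have := hT R hAR hRT
      omega
    obtain ⟨t, htR, htT⟩ := Finset.not_disjoint_iff.1 hnd
    refine ⟨{t}, by simpa using htT, by simp, fun Q hAQ hQ => ?_⟩
    by_contra! hlt
    rw [disjoint_union_right] at hQ
    have hunion := hS (R ∪ Q) (hAR.trans subset_union_left)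
      (disjoint_union_left.2 ⟨hRS, hQ.1⟩)
    have hRQ := hsub R Q
    have hle := hmin (y := R ∩ Q) ⟨subset_inter hAR hAQ,
      hRS.mono_left inter_subset_left, by omega⟩ inter_subset_left
    have htQ : t ∈ Q := (mem_inter.1 (hle htR)).2
    exact Finset.disjoint_left.1 hQ.2 htQ (mem_singleton_self t)
  · push Not at h
    refine ⟨∅, empty_subset _, by simp, fun R hAR hRS => ?_⟩
    have := h R hAR (by simpa using hRS)
    omega

/-- A cut bound against `T` is witnessed by few elements of `T`. -/
theorem CutBound.exists_small [Fintype V] {d : Finset V → ℕ}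
    (hsub : ∀ R S, d (R ∩ S) + d (R ∪ S) ≤ d R + d S) {m : ℕ} {A T : Finset V}
    (hT : CutBound d m A T) : ∃ S ⊆ T, S.card ≤ m ∧ CutBound d m A S := by
  induction m with
  | zero => exact ⟨∅, empty_subset _, by simp, fun _ _ _ => Nat.zero_le _⟩
  | succ m ih =>
    obtain ⟨S, hST, hcard, hS⟩ := ih fun R hR hd => (Nat.le_succ m).trans (hT R hR hd)
    obtain ⟨X, hXT, hX, hSX⟩ := hS.exists_augment hsub hT
    exact ⟨S ∪ X, union_subset hST hXT, (card_union_le _ _).trans (by omega), hSX⟩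

end Submodular

section Reach

variable {V : Type*}

theorem ReachAvoid.not_mem {E : V → V → Prop} {F : Finset V} {u v : V}
    (h : ReachAvoid E F u v) : v ∉ F := by
  obtain ⟨hu, h⟩ := h
  cases h with
  | refl => exact hu
  | tail _ h => exact h.2

theorem ReachAvoid.tail {E : V → V → Prop} {F : Finset V} {u v w : V}
    (h : ReachAvoid E F u v) (hvw : E v w) (hw : w ∉ F) : ReachAvoid E F u w :=
  ⟨h.1, h.2.tail ⟨hvw, hw⟩⟩

theorem ReachAvoid.trans {E : V → V → Prop} {F : Finset V} {u v w : V}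
    (h : ReachAvoid E F u v) (h' : ReachAvoid E F v w) : ReachAvoid E F u w :=
  ⟨h.1, h.2.trans h'.2⟩

theorem ReachAvoid.swap {E : V → V → Prop} {F : Finset V} {u v : V}
    (h : ReachAvoid E F u v) : ReachAvoid (Function.swap E) F v u := by
  obtain ⟨hu, h⟩ := h
  induction h with
  | refl => exact ⟨hu, .refl⟩
  | tail _ hbc ih => exact ⟨hbc.2, .head ⟨hbc.1, ih.1⟩ ih.2⟩

/-- A set containing `u` and closed under arcs avoiding `F` contains everything reached. -/
theorem ReachAvoid.mem_of_closed {E : V → V → Prop} {F : Finset V} {u v : V} {R : Finset V}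
    (h : ReachAvoid E F u v) (hu : u ∈ R) (hR : ∀ a ∈ R, ∀ b, E a b → b ∉ F → b ∈ R) :
    v ∈ R := by
  obtain ⟨-, h⟩ := h
  induction h with
  | refl => exact hu
  | tail _ hbc ih => exact hR _ ih _ hbc.1 hbc.2

theorem ReachAvoid.of_forall_not_mem {E : V → V → Prop} {F F' : Finset V} {u v : V}
    (h : ReachAvoid E F u v) (hF : ∀ w, ReachAvoid E F u w → w ∉ F') :
    ReachAvoid E F' u v := by
  have hu := h.1
  obtain ⟨-, h⟩ := h
  have hu' : u ∉ F' := hF u ⟨hu, .refl⟩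
  induction h with
  | refl => exact ⟨hu', .refl⟩
  | tail hub hbc ih => exact ih.tail hbc.1 (hF _ ⟨hu, hub.tail hbc⟩)

/-- The subsets of `W` of size at most `k`. -/
def smallSubsets (W : Finset V) (k : ℕ) : Finset (Finset V) :=
  W.powerset.filter fun S => S.card ≤ k

theorem mem_smallSubsets {W S : Finset V} {k : ℕ} :
    S ∈ smallSubsets W k ↔ S ⊆ W ∧ S.card ≤ k := by
  simp [smallSubsets]

theorem card_smallSubsets_mul_le (W : Finset V) (k : ℕ) :
    (smallSubsets W k).card * 16 ^ W.card ≤ 16 ^ k * 17 ^ W.card := by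
  have hsum := Finset.sum_pow_mul_eq_add_pow 1 16 W
  calc (smallSubsets W k).card * 16 ^ W.card
      = ∑ _S ∈ smallSubsets W k, 16 ^ W.card := by simp
    _ ≤ ∑ S ∈ smallSubsets W k, 16 ^ k * 16 ^ (W.card - S.card) := by
        refine sum_le_sum fun S hS => ?_
        rw [← pow_add]
        have := (mem_smallSubsets.1 hS).2
        exact Nat.pow_le_pow_right (by norm_num) (by omega)
    _ ≤ ∑ S ∈ W.powerset, 16 ^ k * 16 ^ (W.card - S.card) :=
        sum_le_sum_of_subset (filter_subset _ _)
    _ = 16 ^ k * 17 ^ W.card := by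
        rw [← mul_sum]
        simpa using hsum

theorem card_le_card_smallSubsets (W : Finset V) {k : ℕ} (hk : 0 < k) :
    W.card ≤ (smallSubsets W k).card := by
  rw [← card_map ⟨_, singleton_injective (α := V)⟩]
  refine card_le_card fun S hS => ?_
  obtain ⟨v, hv, rfl⟩ := mem_map.1 hS
  exact mem_smallSubsets.2 ⟨singleton_subset_iff.2 hv, (card_singleton v).trans_le hk⟩

variable [Fintype V]

open Classical in
/-- The out-neighbourhood of `R`, not counting `R` itself. -/
noncomputable def outNbr (E : V → V → Prop) (R : Finset V) : Finset V :=
  univ.filter fun v => v ∉ R ∧ ∃ a ∈ R, E a v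

open Classical in
/-- The set of vertices reachable from `u` in `G∖F`. -/
noncomputable def reachSet (E : V → V → Prop) (u : V) (F : Finset V) : Finset V :=
  univ.filter fun v => ReachAvoid E F u v

theorem mem_outNbr {E : V → V → Prop} {R : Finset V} {v : V} :
    v ∈ outNbr E R ↔ v ∉ R ∧ ∃ a ∈ R, E a v := by
  simp [outNbr]

theorem mem_reachSet {E : V → V → Prop} {F : Finset V} {u v : V} :
    v ∈ reachSet E u F ↔ ReachAvoid E F u v := by
  simp [reachSet]

theorem mem_outNbr_of_subset {E : V → V → Prop} {R S : Finset V} (h : R ⊆ S) {v : V}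
    (hv : v ∈ outNbr E R) (hvS : v ∉ S) : v ∈ outNbr E S := by
  obtain ⟨-, a, ha, hav⟩ := mem_outNbr.1 hv
  exact mem_outNbr.2 ⟨hvS, a, h ha, hav⟩

theorem outNbr_subset_of_disjoint {E : V → V → Prop} {R S D : Finset V} (h : R ⊆ S)
    (hD : D ⊆ outNbr E R) (hSD : Disjoint S D) : D ⊆ outNbr E S :=
  fun _ hx => mem_outNbr_of_subset h (hD hx) (Finset.disjoint_right.1 hSD hx)

theorem outNbr_reachSet_subset (E : V → V → Prop) (u : V) (F : Finset V) :
    outNbr E (reachSet E u F) ⊆ F := by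
  intro v hv
  obtain ⟨hvR, a, ha, hav⟩ := mem_outNbr.1 hv
  by_contra hvF
  exact hvR (mem_reachSet.2 ((mem_reachSet.1 ha).tail hav hvF))

theorem reachSet_subset_of_outNbr_subset {E : V → V → Prop} {u : V} {R F : Finset V}
    (hu : u ∈ R) (hF : outNbr E R ⊆ F) : reachSet E u F ⊆ R := by
  intro v hv
  refine (mem_reachSet.1 hv).mem_of_closed hu fun a ha b hab hb => ?_
  by_contra hbR
  exact hb (hF (mem_outNbr.2 ⟨hbR, a, ha, hab⟩))

theorem reachSet_subset_reachSet {E : V → V → Prop} {u : V} {F F' : Finset V}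
    (h : Disjoint (reachSet E u F) F') : reachSet E u F ⊆ reachSet E u F' :=
  fun _ hv => mem_reachSet.2 <| (mem_reachSet.1 hv).of_forall_not_mem fun _ hw =>
    Finset.disjoint_left.1 h (mem_reachSet.2 hw)

theorem disjoint_outNbr (E : V → V → Prop) (R : Finset V) : Disjoint R (outNbr E R) :=
  Finset.disjoint_right.2 fun _ hv => (mem_outNbr.1 hv).1

theorem reachSet_eq_of_cut {E : V → V → Prop} {u : V} {M D F : Finset V} (hu : u ∈ M)
    (hMD : outNbr E M ⊆ D) (hDF : D ⊆ F) (hMF : Disjoint M F) :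
    reachSet E u F = reachSet E u D := by
  apply Subset.antisymm
  · apply reachSet_subset_reachSet
    exact (hMF.mono_right hDF).mono_left
      (reachSet_subset_of_outNbr_subset hu (hMD.trans hDF))
  · apply reachSet_subset_reachSet
    exact hMF.mono_left (reachSet_subset_of_outNbr_subset hu hMD)

variable [DecidableEq V]

theorem card_outNbr_submodular (E : V → V → Prop) (R S : Finset V) :
    (outNbr E (R ∩ S)).card + (outNbr E (R ∪ S)).card
      ≤ (outNbr E R).card + (outNbr E S).card := by
  rw [← card_union_add_card_inter, ← card_union_add_card_inter (outNbr E R)]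
  apply Nat.add_le_add <;> apply card_le_card <;> intro v <;>
    simp only [mem_union, mem_inter, mem_outNbr] <;> grind

/-- Branching on the vertices of a furthest minimum cut: few vertex sets are reached from `u`
past an out-neighbourhood that cannot be pushed further towards `T`. -/
theorem exists_small_family_of_important (E : V → V → Prop) (u : V) (T : Finset V) (k j : ℕ)
    (A D : Finset V) (m : ℕ) (hu : u ∈ A) (hD : D ⊆ outNbr E A)
    (hm : CutBound (fun R => (outNbr E R).card) m A (T ∪ D)) (hj : 2 * k ≤ j + D.card + m) :
    ∃ 𝒢 : Finset (Finset V), 𝒢.card ≤ 2 ^ j ∧ ∀ R, A ⊆ R → D ⊆ outNbr E R → Disjoint R T →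
      (outNbr E R).card ≤ k →
      (∀ R', R ⊂ R' → Disjoint R' T → (outNbr E R).card < (outNbr E R').card) →
      reachSet E u (outNbr E R) ∈ 𝒢 := by
  have havoid : ∀ {R : Finset V}, D ⊆ outNbr E R → Disjoint R T → Disjoint R (T ∪ D) :=
    fun hDR hRT => disjoint_union_right.2 ⟨hRT, (disjoint_outNbr E _).mono_right hDR⟩
  induction j generalizing A D m with
  | zero =>
    refine ⟨{reachSet E u D}, by simp, fun R hAR hDR hRT hRk _ => ?_⟩
    have hmR := hm R hAR (havoid hDR hRT)
    have hDcard := card_le_card hDR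
    have hDR' : outNbr E R = D := (eq_of_subset_of_card_le hDR (by simp at hmR; omega)).symm
    rw [hDR']
    exact mem_singleton_self _
  | succ j ih =>
    by_cases hm' : CutBound (fun R => (outNbr E R).card) (m + 1) A (T ∪ D)
    · obtain ⟨𝒢, hcard, h𝒢⟩ := ih A D (m + 1) hu hD hm' (by omega) havoid
      exact ⟨𝒢, hcard.trans (Nat.pow_le_pow_right (by norm_num) (Nat.le_succ j)), h𝒢⟩
    unfold CutBound at hm'
    push Not at hm'
    obtain ⟨R₀, hAR₀, hR₀, hcard₀⟩ := hm'
    obtain ⟨M, -, ⟨hAM, hMT, hMm⟩, hmax⟩ := Finite.exists_le_maximal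
      (p := fun R => A ⊆ R ∧ Disjoint R (T ∪ D) ∧ (outNbr E R).card ≤ m)
      ⟨hAR₀, hR₀, Nat.lt_succ_iff.1 hcard₀⟩
    have hMD : Disjoint M D := hMT.mono_right subset_union_right
    have hDM : D ⊆ outNbr E M := outNbr_subset_of_disjoint hAM hD hMD
    have hMR : ∀ R, A ⊆ R → D ⊆ outNbr E R → Disjoint R T →
        (∀ R', R ⊂ R' → Disjoint R' T → (outNbr E R).card < (outNbr E R').card) → M ⊆ R := by
      intro R hAR hDR hRT himp
      have hinter := hm (M ∩ R) (subset_inter hAM hAR) (hMT.mono_left inter_subset_left)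
      have hsub := card_outNbr_submodular E M R
      by_contra hMR
      have hlt := himp (M ∪ R) (ssubset_of_subset_of_ne subset_union_right
        fun h => hMR (h ▸ subset_union_left))
        (disjoint_union_left.2 ⟨hMT.mono_right subset_union_left, hRT⟩)
      simp only at hinter
      omega
    by_cases hMD' : outNbr E M ⊆ D
    · refine ⟨{reachSet E u D}, by simpa using Nat.one_le_two_pow,
        fun R hAR hDR hRT _ himp => ?_⟩
      rw [mem_singleton]
      exact reachSet_eq_of_cut (hAM hu) hMD' hDR
        ((disjoint_outNbr E R).mono_left (hMR R hAR hDR hRT himp))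
    obtain ⟨v, hvM, hvD⟩ := not_subset.1 hMD'
    obtain ⟨𝒢₁, hcard₁, h₁⟩ := ih (insert v M) D (m + 1) (mem_insert_of_mem (hAM hu))
      (outNbr_subset_of_disjoint (subset_insert v M) hDM
        (disjoint_insert_left.2 ⟨hvD, hMD⟩))
      (by
        intro R hvR hRT
        by_contra! hlt
        have hle := hmax (y := R) ⟨hAM.trans ((subset_insert v M).trans hvR), hRT,
          Nat.lt_succ_iff.1 hlt⟩ ((subset_insert v M).trans hvR)
        exact (mem_outNbr.1 hvM).1 (hle (hvR (mem_insert_self v M))))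
      (by omega) havoid
    obtain ⟨𝒢₂, hcard₂, h₂⟩ := ih M (insert v D) m (hAM hu)
      (insert_subset hvM hDM)
      (hm.mono hAM (union_subset_union_right (subset_insert v D)))
      (by rw [card_insert_of_notMem hvD]; omega)
      fun hDR hRT => disjoint_union_right.2 ⟨hRT, (disjoint_outNbr E _).mono_right hDR⟩
    refine ⟨𝒢₁ ∪ 𝒢₂, (card_union_le _ _).trans (by rw [pow_succ]; omega),
      fun R hAR hDR hRT hRk himp => mem_union.2 ?_⟩
    have hM := hMR R hAR hDR hRT himp
    by_cases hvR : v ∈ R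
    · exact .inl (h₁ R (insert_subset hvR hM) hDR hRT hRk himp)
    · exact .inr (h₂ R hM (insert_subset (mem_outNbr_of_subset hM hvM hvR) hDR) hRT hRk himp)

/-- A cut that cannot be pushed towards `T` already cannot be pushed towards a small subset
of `T`. -/
theorem exists_small_important (E : V → V → Prop) {R T : Finset V}
    (himp : ∀ R', R ⊂ R' → Disjoint R' T → (outNbr E R).card < (outNbr E R').card) :
    ∃ S ⊆ T, S.card ≤ 2 * (outNbr E R).card ∧ ∀ f ∈ outNbr E R,
      CutBound (fun R => (outNbr E R).card) ((outNbr E R).card + 1) (insert f R) S := by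
  have hsub := card_outNbr_submodular E
  have hR : CutBound (fun R => (outNbr E R).card) (outNbr E R).card R T := by
    intro R' hRR' hR'
    rcases hRR'.eq_or_ssubset with rfl | h
    · exact le_rfl
    · exact (himp R' h hR').le
  obtain ⟨S, hST, hcard, hS⟩ := hR.exists_small hsub
  have haug : ∀ f ∈ outNbr E R, ∃ X ⊆ T, X.card ≤ 1 ∧ CutBound (fun R => (outNbr E R).card)
      ((outNbr E R).card + 1) (insert f R) (S ∪ X) := by
    intro f hf
    refine (hS.mono (subset_insert f R) Subset.rfl).exists_augment hsub fun R' hR' hd => ?_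
    exact himp R' ((ssubset_insert (mem_outNbr.1 hf).1).trans_subset hR') hd
  choose! X hXT hXcard hX using haug
  refine ⟨S ∪ (outNbr E R).biUnion X, union_subset hST (biUnion_subset.2 hXT), ?_,
    fun f hf => (hX f hf).mono Subset.rfl
      (union_subset_union_right (subset_biUnion_of_mem X hf))⟩
  have := card_biUnion_le_card_mul (outNbr E R) X 1 hXcard
  have := card_union_le S ((outNbr E R).biUnion X)
  omega

/-- Few subsets of `W` are traces of sets reachable from `u` after deleting at most `k`
vertices. -/
theorem exists_small_family_reachSet (E : V → V → Prop) (u : V) (W : Finset V) (k : ℕ) :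
    ∃ ℋ : Finset (Finset V), ℋ.card ≤ (smallSubsets W (2 * k)).card * 4 ^ k ∧
      ∀ F : Finset V, F.card ≤ k → u ∉ F → reachSet E u F ∩ W ∈ ℋ := by
  have hfam := fun S => exists_small_family_of_important E u S k (2 * k) {u} ∅ 0
    (mem_singleton_self u) (empty_subset _) (fun _ _ _ => Nat.zero_le _) (by simp)
  choose 𝒢 hcard h𝒢 using hfam
  refine ⟨((smallSubsets W (2 * k)).biUnion 𝒢).image (· ∩ W), card_image_le.trans
    (card_biUnion_le_card_mul _ _ _ fun S _ => (hcard S).trans_eq (by rw [pow_mul]; norm_num)),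
    fun F hF huF => ?_⟩
  have hu₀ : u ∈ reachSet E u F := mem_reachSet.2 ⟨huF, .refl⟩
  obtain ⟨R, hR₀, ⟨hRT, hRk⟩, hmax⟩ := Finite.exists_le_maximal
    (p := fun R => Disjoint R (W \ reachSet E u F) ∧ (outNbr E R).card ≤ k)
    (a := reachSet E u F)
    ⟨disjoint_sdiff, (card_le_card (outNbr_reachSet_subset E u F)).trans hF⟩
  have himp : ∀ R', R ⊂ R' → Disjoint R' (W \ reachSet E u F) →
      (outNbr E R).card < (outNbr E R').card := by
    intro R' hRR' hR'
    by_contra! hle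
    exact hRR'.2 (hmax ⟨hR', hle.trans hRk⟩ hRR'.1)
  obtain ⟨S, hST, hScard, hS⟩ := exists_small_important E himp
  obtain ⟨Q, hRQ, ⟨hQS, hQR⟩, hQmax⟩ := Finite.exists_le_maximal
    (p := fun Q => Disjoint Q S ∧ (outNbr E Q).card ≤ (outNbr E R).card)
    (a := R) ⟨hRT.mono_right hST, le_rfl⟩
  have hRQ' : outNbr E R = outNbr E Q := by
    refine eq_of_subset_of_card_le (fun f hf => mem_outNbr_of_subset hRQ hf fun hfQ => ?_) hQR
    have := hS f hf Q (insert_subset hfQ hRQ) hQS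
    simp only at this
    omega
  have hmem : reachSet E u (outNbr E R) ∈ 𝒢 S := by
    rw [hRQ']
    refine h𝒢 S Q (singleton_subset_iff.2 (hRQ (hR₀ hu₀))) (empty_subset _) hQS
      (hQR.trans hRk) fun R' hQR' hR' => ?_
    by_contra! hle
    exact hQR'.2 (hQmax ⟨hR', hle.trans hQR⟩ hQR'.1)
  have htrace : reachSet E u (outNbr E R) ∩ W = reachSet E u F ∩ W := by
    apply Subset.antisymm
    · intro v hv
      obtain ⟨hv, hvW⟩ := mem_inter.1 hv
      have hvR := reachSet_subset_of_outNbr_subset (hR₀ hu₀) Subset.rfl hv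
      refine mem_inter.2 ⟨?_, hvW⟩
      by_contra hvF
      exact Finset.disjoint_left.1 hRT hvR (mem_sdiff.2 ⟨hvW, hvF⟩)
    · exact inter_subset_inter_right
        (reachSet_subset_reachSet ((disjoint_outNbr E R).mono_left hR₀))
  refine mem_image.2 ⟨_, mem_biUnion.2 ⟨S, mem_smallSubsets.2
    ⟨hST.trans sdiff_subset, hScard.trans (by omega)⟩, hmem⟩, htrace⟩

/-- Few subsets of `W` are traces of strongly connected components after deleting at most `k`
vertices. -/
theorem exists_small_family_isSCC (E : V → V → Prop) (W : Finset V) (k : ℕ) :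
    ∃ 𝒜 : Finset (Finset V),
      𝒜.card ≤ W.card * ((smallSubsets W (2 * k)).card * 4 ^ k) ^ 2 + 1 ∧
      ∀ F : Finset V, F.card ≤ k → ∀ C, IsSCC E F C → ∃ a ∈ 𝒜, C ∩ ↑W = (↑a : Set V) := by
  choose ℋ hcard hℋ using fun u => exists_small_family_reachSet E u W k
  choose ℋ' hcard' hℋ' using fun u => exists_small_family_reachSet (Function.swap E) u W k
  refine ⟨insert ∅ (W.biUnion fun u => image₂ (· ∩ ·) (ℋ u) (ℋ' u)),
    (card_insert_le _ _).trans (Nat.succ_le_succ (card_biUnion_le_card_mul _ _ _ fun u _ => ?_)),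
    ?_⟩
  · rw [sq]
    exact (card_image₂_le _ _ _).trans (Nat.mul_le_mul (hcard u) (hcard' u))
  rintro F hF C ⟨w, hw, rfl⟩
  by_cases h : ∃ u ∈ W, ReachAvoid E F w u ∧ ReachAvoid E F u w
  · obtain ⟨u, huW, hwu, huw⟩ := h
    refine ⟨(reachSet E u F ∩ W) ∩ (reachSet (Function.swap E) u F ∩ W),
      mem_insert_of_mem (mem_biUnion.2 ⟨u, huW, mem_image₂_of_mem (hℋ u F hF hwu.not_mem)
        (hℋ' u F hF hwu.not_mem)⟩), ?_⟩
    ext v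
    simp only [Set.mem_inter_iff, Set.mem_ofPred_eq, mem_coe, mem_inter, mem_reachSet]
    constructor
    · rintro ⟨⟨hwv, hvw⟩, hv⟩
      exact ⟨⟨huw.trans hwv, hv⟩, (hvw.trans hwu).swap, hv⟩
    · rintro ⟨⟨huv, hv⟩, hvu, -⟩
      exact ⟨⟨hwu.trans huv, hvu.swap.trans huw⟩, hv⟩
  · refine ⟨∅, mem_insert_self _ _, ?_⟩
    ext v
    simp only [Set.mem_inter_iff, Set.mem_ofPred_eq, mem_coe, notMem_empty, iff_false]
    exact fun hv => h ⟨v, hv.2, hv.1⟩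

/-- Few subsets of `W` are traces of members of `SCCFamily E k`. -/
theorem two_pow_card_le_of_shatters (E : V → V → Prop) (k : ℕ) (W : Finset V)
    (h : ∀ Y : Finset V, Y ⊆ W → ∃ C ∈ SCCFamily E k, C ∩ ↑W = (↑Y : Set V)) :
    2 ^ W.card ≤ (W.card * ((smallSubsets W (2 * k)).card * 4 ^ k) ^ 2 + 1) *
      ((smallSubsets W (2 * k)).card + 1) := by
  obtain ⟨𝒜, hcard, h𝒜⟩ := exists_small_family_isSCC E W k
  have hsub : W.powerset ⊆
      𝒜 ∪ image₂ (fun a X => (W \ X) \ a) 𝒜 (smallSubsets W (2 * k)) := by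
    intro Y hY
    obtain ⟨C, ⟨F, hF, hC | ⟨C₀, hC₀, rfl⟩⟩, hCY⟩ := h Y (mem_powerset.1 hY)
    · obtain ⟨a, ha, hCa⟩ := h𝒜 F hF C hC
      rw [hCY, coe_inj] at hCa
      exact mem_union_left _ (hCa ▸ ha)
    · obtain ⟨a, ha, hCa⟩ := h𝒜 F hF C₀ hC₀
      refine mem_union_right _ (mem_image₂.2 ⟨a, ha, F ∩ W, mem_smallSubsets.2
        ⟨inter_subset_right, (card_le_card inter_subset_left).trans (by omega)⟩, ?_⟩)
      ext v
      have h₁ := Set.ext_iff.1 hCa v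
      have h₂ := Set.ext_iff.1 hCY v
      simp only [Set.mem_inter_iff, Set.mem_sdiff, Set.mem_ofPred_eq, mem_coe, mem_inter,
        mem_sdiff] at h₁ h₂ ⊢
      tauto
  have hle := (card_le_card hsub).trans (card_union_le _ _)
  rw [card_powerset] at hle
  calc 2 ^ W.card ≤ 𝒜.card + 𝒜.card * (smallSubsets W (2 * k)).card :=
        hle.trans (Nat.add_le_add_left (card_image₂_le _ _ _) _)
    _ = 𝒜.card * ((smallSubsets W (2 * k)).card + 1) := by ring
    _ ≤ _ := Nat.mul_le_mul_right _ hcard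

end Reach

/-- there is an absolute constant `d` such that for every digraph and
positive integer `k`, every set shattered by the family of SCCs (and complements of
SCCs within `V∖F`) over all deletions `F` of size at most `k` has at most `d·k`
elements, i.e. the family has VC-dimension at most `d·k`. -/
theorem scc_family_vc_dimension :
    ∃ d : ℕ, ∀ (V : Type) [Fintype V] [DecidableEq V] (E : V → V → Prop) (k : ℕ),
      0 < k →
      ∀ W : Finset V,
        (∀ Y : Finset V, Y ⊆ W → ∃ C ∈ SCCFamily E k, C ∩ ↑W = ↑Y) →
        W.card ≤ d * k := by
  refine ⟨76, fun V _ _ E k hk W h => ?_⟩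
  rcases Nat.eq_zero_or_pos W.card with hW | hW
  · omega
  have hshatter := two_pow_card_le_of_shatters E k W h
  have hsmall := card_smallSubsets_mul_le W (2 * k)
  have hWq := card_le_card_smallSubsets W (k := 2 * k) (by omega)
  generalize (smallSubsets W (2 * k)).card = q at *
  generalize W.card = n at *
  have hq : 1 ≤ q := le_trans hW hWq
  have h4 : 4 ≤ 4 ^ k := Nat.le_self_pow hk.ne' 4
  have hpoly : 2 ^ n ≤ 64 ^ k * q ^ 4 := by
    have hone : 1 ≤ q * (q * 4 ^ k) ^ 2 := Nat.one_le_iff_ne_zero.2 (by positivity)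
    calc 2 ^ n ≤ (n * (q * 4 ^ k) ^ 2 + 1) * (q + 1) := hshatter
      _ ≤ (q * (q * 4 ^ k) ^ 2 + q * (q * 4 ^ k) ^ 2) * (q + q) := by gcongr
      _ = 4 * ((4 ^ k) ^ 2 * q ^ 4) := by ring
      _ ≤ 4 ^ k * ((4 ^ k) ^ 2 * q ^ 4) := Nat.mul_le_mul_right _ h4
      _ = 64 ^ k * q ^ 4 := by
        rw [← mul_assoc, ← pow_succ', ← pow_mul, mul_comm k, pow_mul]
        norm_num
  have hroot : 131072 ^ n ≤ 2 ^ (38 * k) * 83521 ^ n := by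
    calc 131072 ^ n = 2 ^ n * (16 ^ n) ^ 4 := by
          rw [← pow_mul, mul_comm n, pow_mul, ← mul_pow]
          norm_num
      _ ≤ (64 ^ k * q ^ 4) * (16 ^ n) ^ 4 := Nat.mul_le_mul_right _ hpoly
      _ = 64 ^ k * (q * 16 ^ n) ^ 4 := by ring
      _ ≤ 64 ^ k * (16 ^ (2 * k) * 17 ^ n) ^ 4 := by gcongr
      _ = 2 ^ (38 * k) * 83521 ^ n := by
        rw [mul_pow, ← pow_mul 17, mul_comm n 4, pow_mul 17, ← mul_assoc, ← pow_mul,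
          show 2 * k * 4 = 8 * k by ring, pow_mul 16, ← mul_pow, pow_mul 2]
        norm_num
  have hfinal : 2 ^ n * (83521 ^ n) ^ 2 ≤ 2 ^ (76 * k) * (83521 ^ n) ^ 2 := by
    calc 2 ^ n * (83521 ^ n) ^ 2 = (2 * 83521 ^ 2) ^ n := by
          rw [mul_pow, ← pow_mul, ← pow_mul, mul_comm n]
      _ ≤ (131072 ^ 2) ^ n := Nat.pow_le_pow_left (by norm_num) n
      _ = (131072 ^ n) ^ 2 := by rw [← pow_mul, ← pow_mul, mul_comm n]
      _ ≤ (2 ^ (38 * k) * 83521 ^ n) ^ 2 := Nat.pow_le_pow_left hroot 2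
      _ = 2 ^ (76 * k) * (83521 ^ n) ^ 2 := by
        rw [mul_pow, ← pow_mul 2, show 38 * k * 2 = 76 * k by ring]
  exact (Nat.pow_le_pow_iff_right (by norm_num)).1
    (Nat.le_of_mul_le_mul_right hfinal (by positivity))
end

section
/- Let G be a digraph, let v ∈ V(G), let A, Y ⊆ V(G) with v ∉ Y and v ∉ A, and let G' be the digraph obtained from G by closing v. Then (1) R^A_{G'}(Y) ⊆ R^A_{G}(Y), and (2) R^A_{G}(Y)∖{v} ⊆ R^A_{G'}(Y). -/
/-- A digraph on vertex type `V` is given by its arc relation `E : V → V → Prop`.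
`RSet E S X` is the set of vertices reachable in `G∖X` by a directed path from
some vertex of `S∖X` (every vertex of `S∖X` reaches itself). -/
def RSet {V : Type*} (E : V → V → Prop) (S X : Finset V) : Set V :=
  {v | ∃ s ∈ S, s ∉ X ∧ Relation.ReflTransGen (fun a b => E a b ∧ b ∉ X) s v}

/-- `X` is an `A`-`B` separator: in `G∖X` no vertex of `B∖X` is reachable from `A∖X`. -/
def IsSep {V : Type*} (E : V → V → Prop) (A B X : Finset V) : Prop :=
  ∀ b ∈ B, b ∉ RSet E A X

/-- `X` is a minimal `A`-`B` separator. -/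
def IsMinSep {V : Type*} [DecidableEq V] (E : V → V → Prop) (A B X : Finset V) : Prop :=
  IsSep E A B X ∧ ∀ v ∈ X, ¬ IsSep E A B (X.erase v)

/-- `X` is an important `A`-`B` separator. -/
def IsImpSep {V : Type*} [DecidableEq V] (E : V → V → Prop) (A B X : Finset V) : Prop :=
  IsMinSep E A B X ∧
    ¬ ∃ X' : Finset V, IsSep E A B X' ∧ X'.card ≤ X.card ∧ RSet E A X ⊂ RSet E A X'

/-- `prefBinom x c = C(x, ≤c) = Σ_{i=1}^{c} binom(x, i)`. -/
def prefBinom (x c : ℕ) : ℕ := ∑ i ∈ Finset.Icc 1 c, Nat.choose x i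

/-- The digraph obtained from `G` by closing the vertex `v`: the vertex set is
`V(G)∖{v}` (modelled by making `v` isolated) and the arcs are all arcs of `G` not
incident to `v`, plus a shortcut `(u,w)` whenever `(u,v)` and `(v,w)` are arcs of `G`. -/
def closeV {V : Type*} (E : V → V → Prop) (v : V) (a b : V) : Prop :=
  a ≠ v ∧ b ≠ v ∧ (E a b ∨ (E a v ∧ E v b))

/-- Along a path of `G∖Y` starting away from `v`, every vertex other than `v` is reached in the
closure of `v`, and `v` itself is entered from a vertex reached there. -/
theorem reflTransGen_closeV {V : Type*} {E : V → V → Prop} {v s x : V} {Y : Finset V}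
    (hs : s ≠ v) (h : Relation.ReflTransGen (fun a b => E a b ∧ b ∉ Y) s x) :
    (x ≠ v → Relation.ReflTransGen (fun a b => closeV E v a b ∧ b ∉ Y) s x) ∧
      (x = v → ∃ u, u ≠ v ∧ E u v ∧
        Relation.ReflTransGen (fun a b => closeV E v a b ∧ b ∉ Y) s u) := by
  induction h with
  | refl => exact ⟨fun _ => .refl, fun h => absurd h hs⟩
  | @tail b c _ hbc ih =>
    obtain ⟨hE, hc⟩ := hbc
    by_cases hb : b = v
    · obtain ⟨u, hu, huv, hsu⟩ := ih.2 hb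
      subst hb
      exact ⟨fun hcv => hsu.tail ⟨⟨hu, hcv, .inr ⟨huv, hE⟩⟩, hc⟩, fun _ => ⟨u, hu, huv, hsu⟩⟩
    · refine ⟨fun hcv => (ih.1 hb).tail ⟨⟨hb, hcv, .inl hE⟩, hc⟩, ?_⟩
      rintro rfl
      exact ⟨b, hb, hE, ih.1 hb⟩

/-- closing a vertex `v ∉ A ∪ Y` preserves reachability:
`R^A_{G'}(Y) ⊆ R^A_G(Y)` and `R^A_G(Y) ∖ {v} ⊆ R^A_{G'}(Y)`. -/
theorem closure_reachability
    (V : Type*) [Fintype V] [DecidableEq V] (E : V → V → Prop)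
    (v : V) (A Y : Finset V) (hvY : v ∉ Y) (hvA : v ∉ A) :
    RSet (closeV E v) A Y ⊆ RSet E A Y ∧
      RSet E A Y \ {v} ⊆ RSet (closeV E v) A Y := by
  constructor
  · rintro x ⟨s, hsA, hsY, h⟩
    refine ⟨s, hsA, hsY, ?_⟩
    induction h with
    | refl => exact .refl
    | tail _ hbc ih =>
      obtain ⟨⟨_, _, hE | ⟨hbv, hvc⟩⟩, hc⟩ := hbc
      · exact ih.tail ⟨hE, hc⟩
      · exact (ih.tail ⟨hbv, hvY⟩).tail ⟨hvc, hc⟩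
  · rintro x ⟨⟨s, hsA, hsY, h⟩, hxv⟩
    exact ⟨s, hsA, hsY, (reflTransGen_closeV (ne_of_mem_of_not_mem hsA hvA) h).1 hxv⟩
end

section
/- Let G be a digraph, let A, B ⊆ V(G) be disjoint, let c be a positive integer, and let v ∈ V(G)∖(A ∪ B) be a vertex that does not belong to any important A-B separator of size at most c in G. Let G' be the digraph obtained from G by closing v. If X ⊆ V(G') with |X| ≤ c is an important A-B separator in G', then X is an important A-B separator in G. -/
theorem RSet_step {V : Type*} {E : V → V → Prop} {S X : Finset V} {a b : V}
    (ha : a ∈ RSet E S X) (hab : E a b) (hb : b ∉ X) : b ∈ RSet E S X := by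
  obtain ⟨s, hs, hsX, h⟩ := ha
  exact ⟨s, hs, hsX, h.tail ⟨hab, hb⟩⟩

theorem RSet_anti {V : Type*} {E : V → V → Prop} {S X Y : Finset V} (h : X ⊆ Y) :
    RSet E S Y ⊆ RSet E S X := by
  rintro w ⟨s, hs, hsY, hw⟩
  refine ⟨s, hs, fun hX => hsY (h hX), ?_⟩
  exact Relation.ReflTransGen.mono (fun _ _ hab => ⟨hab.1, fun hX => hab.2 (h hX)⟩) _ _ hw

/-- Closing `v` does not change which vertices other than `v` are reachable. -/
theorem RSet_closeV {V : Type*} {E : V → V → Prop} {S X : Finset V} {v : V}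
    (hvS : v ∉ S) (hvX : v ∉ X) : RSet (closeV E v) S X = RSet E S X \ {v} := by
  ext w
  constructor
  · rintro ⟨s, hs, hsX, h⟩
    induction h with
    | refl => exact ⟨⟨s, hs, hsX, .refl⟩, fun h => hvS (h ▸ hs)⟩
    | tail _ hab ih =>
      obtain ⟨⟨-, hb, hE⟩, hbX⟩ := hab
      refine ⟨?_, hb⟩
      rcases hE with hE | ⟨hav, hvb⟩
      · exact RSet_step ih.1 hE hbX
      · exact RSet_step (RSet_step ih.1 hav hvX) hvb hbX
  · rintro ⟨⟨s, hs, hsX, h⟩, hw⟩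
    have key : (w ≠ v → w ∈ RSet (closeV E v) S X) ∧
        (w = v → ∃ u ∈ RSet (closeV E v) S X, u ≠ v ∧ E u v) := by
      clear hw
      induction h with
      | refl => exact ⟨fun _ => ⟨s, hs, hsX, .refl⟩, fun h => absurd (h ▸ hs) hvS⟩
      | @tail a b _ hab ih =>
        obtain ⟨hE, hbX⟩ := hab
        by_cases ha : a = v
        · obtain ⟨u, hu, huv, hEu⟩ := ih.2 ha
          subst ha
          exact ⟨fun hb => RSet_step hu ⟨huv, hb, .inr ⟨hEu, hE⟩⟩ hbX,
            fun _ => ⟨u, hu, huv, hEu⟩⟩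
        · exact ⟨fun hb => RSet_step (ih.1 ha) ⟨ha, hb, .inl hE⟩ hbX,
            fun hb => ⟨a, ih.1 ha, ha, hb ▸ hE⟩⟩
    exact key.1 hw

/-- A vertex outside `S` that is reachable in `G∖X` has a reachable in-neighbour other than
itself. -/
theorem exists_pred_of_mem_RSet {V : Type*} {E : V → V → Prop} {S X : Finset V} {v : V}
    (hvS : v ∉ S) (hv : v ∈ RSet E S X) : ∃ u ∈ RSet E S X, u ≠ v ∧ E u v := by
  obtain ⟨s, hs, hsX, h⟩ := hv
  have key : ∀ w, Relation.ReflTransGen (fun a b => E a b ∧ b ∉ X) s w → w = v →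
      ∃ u ∈ RSet E S X, u ≠ v ∧ E u v := by
    intro w hw
    induction hw with
    | refl => exact fun h => absurd (h ▸ hs) hvS
    | @tail a b hsa hab ih =>
      intro hb
      by_cases ha : a = v
      · exact ih ha
      · exact ⟨a, ⟨s, hs, hsX, hsa⟩, ha, hb ▸ hab.1⟩
  exact key v h rfl

theorem isSep_closeV_iff {V : Type*} {E : V → V → Prop} {A B X : Finset V} {v : V}
    (hvA : v ∉ A) (hvB : v ∉ B) (hvX : v ∉ X) :
    IsSep (closeV E v) A B X ↔ IsSep E A B X := by
  unfold IsSep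
  rw [RSet_closeV hvA hvX]
  exact ⟨fun h b hb hR => h b hb ⟨hR, fun hbv => hvB (hbv ▸ hb)⟩, fun h b hb hR => h b hb hR.1⟩

/-- Every separator is dominated by an important separator. -/
theorem IsSep.exists_isImpSep {V : Type*} [Finite V] [DecidableEq V] {E : V → V → Prop}
    {A B Y : Finset V} (hY : IsSep E A B Y) :
    ∃ Z, IsImpSep E A B Z ∧ Z.card ≤ Y.card ∧ RSet E A Y ⊆ RSet E A Z := by
  obtain ⟨M, ⟨hM, hMc, hMR⟩, hmax⟩ :=
    (Set.toFinite {M | IsSep E A B M ∧ M.card ≤ Y.card ∧ RSet E A Y ⊆ RSet E A M}).exists_maximalFor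
      (RSet E A) _ ⟨Y, hY, le_rfl, subset_rfl⟩
  obtain ⟨Z, hZM, hZ⟩ := exists_minimal_le_of_wellFoundedLT (IsSep E A B) M hM
  have hMZ := RSet_anti (E := E) (S := A) hZM
  have hZc := (Finset.card_le_card hZM).trans hMc
  refine ⟨Z, ⟨⟨hZ.prop, fun w hw h => ?_⟩, ?_⟩, hZc, hMR.trans hMZ⟩
  · exact hZ.not_prop_of_lt (Finset.erase_ssubset hw) h
  · rintro ⟨W, hW, hWc, hWR⟩
    have hMW := hMZ.trans hWR.subset
    exact hWR.not_subset ((hmax ⟨hW, hWc.trans hZc, hMR.trans hMW⟩ hMW).trans hMZ)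

/-- let `v ∉ A ∪ B` be a vertex in no important `A`-`B` separator of size
at most `c` in `G`, and let `G'` be obtained from `G` by closing `v`. Then every
important `A`-`B` separator `X ⊆ V(G')` with `|X| ≤ c` in `G'` is an important `A`-`B`
separator in `G`. -/
theorem closure_preserves_important_backward
    (V : Type*) [Fintype V] [DecidableEq V] (E : V → V → Prop)
    (A B : Finset V) (hAB : Disjoint A B) (c : ℕ) (hc : 0 < c)
    (v : V) (hvA : v ∉ A) (hvB : v ∉ B)
    (hv : ∀ Z : Finset V, Z.card ≤ c → IsImpSep E A B Z → v ∉ Z)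
    (X : Finset V) (hvX : v ∉ X) (hXc : X.card ≤ c)
    (hX : IsImpSep (closeV E v) A B X) :
    IsImpSep E A B X := by
  obtain ⟨⟨hsep, hmin⟩, himp⟩ := hX
  refine ⟨⟨(isSep_closeV_iff hvA hvB hvX).1 hsep, fun w hw h => hmin w hw ?_⟩, ?_⟩
  · exact (isSep_closeV_iff hvA hvB fun hv => hvX (Finset.mem_of_mem_erase hv)).2 h
  · rintro ⟨Y, hY, hYc, hYR⟩
    obtain ⟨Z, hZ, hZc, hYZ⟩ := hY.exists_isImpSep
    have hZX := hZc.trans hYc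
    have hvZ := hv Z (hZX.trans hXc) hZ
    have hXZ := hYR.trans_subset hYZ
    refine himp ⟨Z, (isSep_closeV_iff hvA hvB hvZ).2 hZ.1.1, hZX, ?_⟩
    rw [RSet_closeV hvA hvX, RSet_closeV hvA hvZ]
    refine ⟨Set.sdiff_subset_sdiff_left hXZ.subset, fun hle => hXZ.not_subset fun w hw => ?_⟩
    by_cases hwv : w = v
    · subst hwv
      obtain ⟨u, hu, huw, hE⟩ := exists_pred_of_mem_RSet hvA hw
      exact RSet_step (hle ⟨hu, huw⟩).1 hE hvX
    · exact (hle ⟨hw, hwv⟩).1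
end

section
/- Let G be a digraph, let A, B ⊆ V(G) be disjoint, let c be a positive integer, and let v ∈ V(G)∖(A ∪ B) be a vertex that does not belong to any important A-B separator of size at most c in G. Let G' be the digraph obtained from G by closing v. If X ⊆ V(G) with |X| ≤ c is an important A-B separator in G, then v ∉ X and X is an important A-B separator in G'. -/
theorem RSet.step {V : Type*} {E : V → V → Prop} {A X : Finset V} {a b : V}
    (ha : a ∈ RSet E A X) (hab : E a b) (hb : b ∉ X) : b ∈ RSet E A X := by
  obtain ⟨s, hs, hsX, h⟩ := ha
  exact ⟨s, hs, hsX, h.tail ⟨hab, hb⟩⟩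

/-- Induction along the arcs of `G∖X` on the vertices reachable from `A∖X`. -/
theorem RSet.rec_on {V : Type*} {E : V → V → Prop} {A X : Finset V} {P : V → Prop}
    (base : ∀ s ∈ A, s ∉ X → P s)
    (step : ∀ a b, a ∈ RSet E A X → P a → E a b → b ∉ X → P b)
    {w : V} (hw : w ∈ RSet E A X) : P w := by
  obtain ⟨s, hs, hsX, h⟩ := hw
  induction h with
  | refl => exact base s hs hsX
  | tail hsb hbc ih => exact step _ _ ⟨s, hs, hsX, hsb⟩ ih hbc.1 hbc.2

/-- A vertex outside `A` that is reachable from `A` has a reachable in-neighbour other than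
itself. -/
theorem RSet.exists_pred {V : Type*} {E : V → V → Prop} {A X : Finset V} {v : V}
    (hvA : v ∉ A) (hv : v ∈ RSet E A X) : ∃ u ∈ RSet E A X, u ≠ v ∧ E u v := by
  refine RSet.rec_on (P := fun w => w = v → ∃ u ∈ RSet E A X, u ≠ v ∧ E u v)
    ?_ ?_ hv rfl
  · rintro s hs - rfl
    exact absurd hs hvA
  · rintro a b ha ih hab - rfl
    by_cases h : a = b
    · exact ih h
    · exact ⟨a, ha, h, hab⟩

theorem mem_RSet_closeV_iff {V : Type*} {E : V → V → Prop} {A X : Finset V} {v : V}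
    (hvA : v ∉ A) (hvX : v ∉ X) (w : V) :
    w ∈ RSet (closeV E v) A X ↔ w ∈ RSet E A X ∧ w ≠ v := by
  constructor
  · refine RSet.rec_on (P := fun w => w ∈ RSet E A X ∧ w ≠ v) ?_ ?_
    · exact fun s hs hsX => ⟨⟨s, hs, hsX, .refl⟩, fun h => hvA (h ▸ hs)⟩
    · rintro a b - ⟨ha, -⟩ ⟨-, hbv, hab | ⟨hav, hvb⟩⟩ hbX
      · exact ⟨RSet.step ha hab hbX, hbv⟩
      · exact ⟨RSet.step (RSet.step ha hav hvX) hvb hbX, hbv⟩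
  · rintro ⟨hw, hwv⟩
    refine (RSet.rec_on (P := fun w => (w ≠ v → w ∈ RSet (closeV E v) A X) ∧
      (w = v → ∃ u ∈ RSet (closeV E v) A X, u ≠ v ∧ E u v)) ?_ ?_ hw).1 hwv
    · exact fun s hs hsX => ⟨fun _ => ⟨s, hs, hsX, .refl⟩, fun h => absurd hs (h ▸ hvA)⟩
    · rintro a b - ⟨h₁, h₂⟩ hab hbX
      by_cases hav : a = v
      · obtain ⟨u, hu, huv, huE⟩ := h₂ hav
        exact ⟨fun hbv => RSet.step hu ⟨huv, hbv, .inr ⟨huE, hav ▸ hab⟩⟩ hbX,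
          fun _ => ⟨u, hu, huv, huE⟩⟩
      · exact ⟨fun hbv => RSet.step (h₁ hav) ⟨hav, hbv, .inl hab⟩ hbX,
          fun hbv => ⟨a, h₁ hav, hav, hbv ▸ hab⟩⟩

theorem RSet_closeV_erase {V : Type*} [DecidableEq V] {E : V → V → Prop} {A : Finset V} {v : V}
    (hvA : v ∉ A) (X : Finset V) :
    RSet (closeV E v) A (X.erase v) = RSet (closeV E v) A X := by
  ext w
  constructor
  · exact RSet.rec_on
      (fun s hs hsX => ⟨s, hs, fun h => hsX (Finset.mem_erase.2 ⟨fun hsv => hvA (hsv ▸ hs), h⟩),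
        .refl⟩)
      fun a b _ ha hab hb => RSet.step ha hab fun h => hb (Finset.mem_erase.2 ⟨hab.2.1, h⟩)
  · exact RSet.rec_on (fun s hs hsX => ⟨s, hs, mt Finset.mem_of_mem_erase hsX, .refl⟩)
      fun a b _ ha hab hb => RSet.step ha hab (mt Finset.mem_of_mem_erase hb)

/-- Proper inclusion of the sets reachable after closing `v` implies proper inclusion of the sets
reachable before. -/
theorem RSet_ssubset_of_closeV {V : Type*} {E : V → V → Prop} {A X Y : Finset V} {v : V}
    (hvA : v ∉ A) (hvX : v ∉ X) (hvY : v ∉ Y)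
    (h : RSet (closeV E v) A X ⊂ RSet (closeV E v) A Y) : RSet E A X ⊂ RSet E A Y := by
  have sub_of_ne : ∀ w ∈ RSet E A X, w ≠ v → w ∈ RSet E A Y := fun w hw hwv =>
    ((mem_RSet_closeV_iff hvA hvY w).1 (h.1 ((mem_RSet_closeV_iff hvA hvX w).2 ⟨hw, hwv⟩))).1
  refine ⟨fun w hw => ?_, fun hYX => h.2 fun w hw => ?_⟩
  · by_cases hwv : w = v
    · subst hwv
      obtain ⟨u, hu, huw, huE⟩ := RSet.exists_pred hvA hw
      exact RSet.step (sub_of_ne u hu huw) huE hvY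
    · exact sub_of_ne w hw hwv
  · obtain ⟨hwY, hwv⟩ := (mem_RSet_closeV_iff hvA hvY w).1 hw
    exact (mem_RSet_closeV_iff hvA hvX w).2 ⟨hYX hwY, hwv⟩

/-- let `v ∉ A ∪ B` be a vertex in no important `A`-`B` separator of size
at most `c` in `G`, and let `G'` be obtained from `G` by closing `v`. Then every
important `A`-`B` separator `X` with `|X| ≤ c` in `G` avoids `v` and is an important
`A`-`B` separator in `G'`. -/
theorem closure_preserves_important_forward
    (V : Type*) [Fintype V] [DecidableEq V] (E : V → V → Prop)
    (A B : Finset V) (hAB : Disjoint A B) (c : ℕ) (hc : 0 < c)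
    (v : V) (hvA : v ∉ A) (hvB : v ∉ B)
    (hv : ∀ Z : Finset V, Z.card ≤ c → IsImpSep E A B Z → v ∉ Z)
    (X : Finset V) (hXc : X.card ≤ c) (hX : IsImpSep E A B X) :
    v ∉ X ∧ IsImpSep (closeV E v) A B X := by
  have hvX : v ∉ X := hv X hXc hX
  obtain ⟨⟨hsep, hmin⟩, himp⟩ := hX
  refine ⟨hvX, ⟨(isSep_closeV_iff hvA hvB hvX).2 hsep, fun u hu h => hmin u hu ?_⟩, ?_⟩
  · exact (isSep_closeV_iff hvA hvB fun h => hvX (Finset.mem_of_mem_erase h)).1 h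
  · rintro ⟨Y, hYsep, hYcard, hYX⟩
    have hvY : v ∉ Y.erase v := Finset.notMem_erase v Y
    refine himp ⟨Y.erase v, (isSep_closeV_iff hvA hvB hvY).1 ?_,
      Finset.card_erase_le.trans hYcard, RSet_ssubset_of_closeV hvA hvX hvY ?_⟩
    · unfold IsSep
      rwa [RSet_closeV_erase hvA]
    · rwa [RSet_closeV_erase hvA]
end

section
/- Let H be a digraph on n ≥ 1 vertices and let β ∈ (0,1) be such that every strongly connected component of H has at most βn vertices. Then there exists a set A ⊆ V(H) such that H has no arc from a vertex of V(H)∖A to a vertex of A, and both |A| ≥ (1−β)n/2 and |V(H)∖A| ≥ (1−β)n/2. -/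
open Relation in
/-- A nonempty finite set contains a vertex `u` that is reachable from every vertex of the set
reachable from `u`. -/
theorem exists_mem_forall_reflTransGen_symm {V : Type*} (E : V → V → Prop) {A : Finset V}
    (hA : A.Nonempty) :
    ∃ u ∈ A, ∀ v ∈ A, ReflTransGen E u v → ReflTransGen E v u := by
  classical
  obtain ⟨u, hu, hmin⟩ :=
    A.exists_min_image (fun u => (A.filter fun v => ReflTransGen E u v).card) hA
  refine ⟨u, hu, fun v hv huv => ?_⟩
  have hsub : (A.filter fun w => ReflTransGen E v w) ⊆ A.filter fun w => ReflTransGen E u w :=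
    fun w hw => by
      rw [Finset.mem_filter] at hw ⊢
      exact ⟨hw.1, huv.trans hw.2⟩
  have hmem : u ∈ A.filter fun w => ReflTransGen E v w := by
    rw [Finset.eq_of_subset_of_card_le hsub (hmin v hv)]
    exact Finset.mem_filter.2 ⟨hu, .refl⟩
  exact (Finset.mem_filter.1 hmem).2

/-- With nothing to avoid, `ReachAvoid` is reachability. -/
theorem reachAvoid_empty {V : Type*} (E : V → V → Prop) (u v : V) :
    ReachAvoid E ∅ u v ↔ Relation.ReflTransGen E u v := by
  simp [ReachAvoid]

/-- A nonempty set that no arc enters from outside contains a strongly connected component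
whose removal leaves a set that no arc enters from outside. -/
theorem exists_isSCC_subset_sdiff_closed {V : Type*} [DecidableEq V] (E : V → V → Prop)
    {A : Finset V} (hne : A.Nonempty) (hA : ∀ x ∉ A, ∀ y ∈ A, ¬ E x y) :
    ∃ C ⊆ A, C.Nonempty ∧ IsSCC E ∅ (C : Set V) ∧ ∀ x ∉ A \ C, ∀ y ∈ A \ C, ¬ E x y := by
  classical
  obtain ⟨u, hu, hsymm⟩ := exists_mem_forall_reflTransGen_symm E hne
  have hpred : ∀ v, Relation.ReflTransGen E v u → v ∈ A := fun v hv => by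
    induction hv using Relation.ReflTransGen.head_induction_on with
    | refl => exact hu
    | head hxy _ ih => exact by_contra fun hx => hA _ hx _ ih hxy
  refine ⟨A.filter fun v => Relation.ReflTransGen E u v, Finset.filter_subset _ _,
    ⟨u, Finset.mem_filter.2 ⟨hu, .refl⟩⟩, ⟨u, Finset.notMem_empty u, ?_⟩, ?_⟩
  · ext v
    simp only [Finset.coe_filter, Set.mem_ofPred_eq, reachAvoid_empty]
    exact ⟨fun h => ⟨h.2, hsymm v h.1 h.2⟩, fun h => ⟨hpred v h.2, h.1⟩⟩
  · intro x hx y hy hxy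
    simp only [Finset.mem_sdiff, Finset.mem_filter, not_and] at hx hy
    have hxA : x ∈ A := by_contra fun h => hA x h y hy.1 hxy
    exact hx hxA fun _ hux => hy.2 hy.1 (hux.tail hxy)

/-- if every SCC of a digraph `H` on `n ≥ 1` vertices has at most `βn`
vertices, then there is a set `A` with no arc entering it from outside such that both
`A` and its complement have at least `(1−β)n/2` vertices. -/
theorem balanced_prefix_of_topological_order
    (V : Type*) [Fintype V] [DecidableEq V] (E : V → V → Prop)
    (hn : 1 ≤ Fintype.card V) (β : ℝ) (hβ : β ∈ Set.Ioo (0 : ℝ) 1)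
    (hSCC : ∀ C : Set V, IsSCC E (∅ : Finset V) C →
      (C.ncard : ℝ) ≤ β * (Fintype.card V : ℝ)) :
    ∃ A : Finset V,
      (∀ x : V, x ∉ A → ∀ y ∈ A, ¬ E x y) ∧
      (1 - β) * (Fintype.card V : ℝ) / 2 ≤ (A.card : ℝ) ∧
      (1 - β) * (Fintype.card V : ℝ) / 2 ≤ (Aᶜ.card : ℝ) := by
  classical
  obtain ⟨hβ0, hβ1⟩ := hβ
  have hn' : (1 : ℝ) ≤ Fintype.card V := by exact_mod_cast hn
  let S : Finset (Finset V) := Finset.univ.filter fun A =>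
    (∀ x ∉ A, ∀ y ∈ A, ¬ E x y) ∧ (1 - β) * (Fintype.card V : ℝ) / 2 ≤ (A.card : ℝ)
  have hS : S.Nonempty :=
    ⟨Finset.univ, by
      simp only [S, Finset.mem_filter, Finset.mem_univ, not_true_eq_false, Finset.card_univ]
      refine ⟨trivial, fun _ h => h.elim, by nlinarith⟩⟩
  obtain ⟨A, hAS, hmin⟩ := S.exists_min_image Finset.card hS
  obtain ⟨hA, hcard⟩ := (Finset.mem_filter.1 hAS).2
  refine ⟨A, hA, hcard, ?_⟩
  have hne : A.Nonempty := by
    rw [← Finset.card_pos, ← Nat.cast_pos (α := ℝ)]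
    nlinarith
  obtain ⟨C, hCA, hCne, hC, hclosed⟩ := exists_isSCC_subset_sdiff_closed E hne hA
  have hCcard := hSCC _ hC
  rw [Set.ncard_coe_finset] at hCcard
  have hsplit : ((A \ C).card : ℝ) + C.card = A.card := by
    exact_mod_cast Finset.card_sdiff_add_card_eq_card hCA
  have hsmall : ((A \ C).card : ℝ) < (1 - β) * (Fintype.card V : ℝ) / 2 := by
    by_contra! h
    have hle := hmin _ (Finset.mem_filter.2 ⟨Finset.mem_univ _, hclosed, h⟩)
    exact (Finset.card_lt_card (Finset.sdiff_ssubset hCA hCne)).not_ge hle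
  have hcompl : (A.card : ℝ) + (Aᶜ.card : ℝ) = Fintype.card V := by
    exact_mod_cast A.card_add_card_compl
  linarith
end

section
/- For every digraph G and every nonempty set of terminals T ⊆ V(G), there exists a digraph G' with T ⊆ V(G') ⊆ V(G) and |V(G')| ≤ |T| + |T| · 2^{|T|}, such that for every partition (A,B) of T, the minimum size of an A-B separator in G' equals the minimum size of an A-B separator in G. (In particular, G' is a (|T|,T) vertex cut sparsifier of G of size O(|T|·2^{|T|}).) -/
/-- The minimum size of an `A`-`B` separator. -/
noncomputable def minSepSize {V : Type*} (E : V → V → Prop) (A B : Finset V) : ℕ :=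
  sInf {m : ℕ | ∃ X : Finset V, IsSep E A B X ∧ X.card = m}

/-- The closure (torso) of the digraph `E` on `W`: an arc joins `x` to `y` in `W` whenever `E`
has a nontrivial walk from `x` to `y` whose internal vertices avoid `W`. -/
def closureArcs {V : Type*} (E : V → V → Prop) (W : Finset V) (x y : V) : Prop :=
  x ∈ W ∧ y ∈ W ∧ ∃ z, Relation.ReflTransGen (fun a b => E a b ∧ b ∉ W) x z ∧ E z y

theorem isSep_left {V : Type*} (E : V → V → Prop) (A B : Finset V) : IsSep E A B A :=
  fun _ _ ⟨_, hs, hs', _⟩ => hs' hs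

theorem minSepSize_le {V : Type*} {E : V → V → Prop} {A B X : Finset V} (h : IsSep E A B X) :
    minSepSize E A B ≤ X.card :=
  Nat.sInf_le ⟨X, h, rfl⟩

theorem exists_isSep_card_eq_minSepSize {V : Type*} (E : V → V → Prop) (A B : Finset V) :
    ∃ X : Finset V, IsSep E A B X ∧ X.card = minSepSize E A B :=
  Nat.sInf_mem (s := {m : ℕ | ∃ X : Finset V, IsSep E A B X ∧ X.card = m})
    ⟨_, A, isSep_left E A B, rfl⟩

theorem IsSep.closureArcs {V : Type*} {E : V → V → Prop} {W A B X : Finset V}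
    (h : IsSep E A B X) (hX : X ⊆ W) : IsSep (closureArcs E W) A B X := by
  rintro b hb ⟨s, hs, hsX, hp⟩
  refine h b hb ⟨s, hs, hsX, ?_⟩
  clear hb
  induction hp with
  | refl => exact .refl
  | tail _ hstep ih =>
    obtain ⟨⟨_, _, z, hz, hzy⟩, hyX⟩ := hstep
    refine (ih.trans ?_).tail ⟨hzy, hyX⟩
    exact Relation.ReflTransGen.mono
      (fun _ _ hab => ⟨hab.1, fun hbX => hab.2 (hX hbX)⟩) _ _ hz

theorem IsSep.of_closureArcs {V : Type*} [DecidableEq V] {E : V → V → Prop} {W A B X : Finset V}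
    (h : IsSep (_root_.closureArcs E W) A B X) (hA : A ⊆ W) (hB : B ⊆ W) :
    IsSep E A B (X ∩ W) := by
  rintro b hb ⟨s, hs, hsX, hp⟩
  have hsX' : s ∉ X := fun hx => hsX (Finset.mem_inter.2 ⟨hx, hA hs⟩)
  have key : ∃ w ∈ W,
      Relation.ReflTransGen (fun a b => _root_.closureArcs E W a b ∧ b ∉ X) s w ∧
      Relation.ReflTransGen (fun a b => E a b ∧ b ∉ W) w b ∧ (b ∈ W → w = b) := by
    clear hb
    induction hp with
    | refl => exact ⟨s, hA hs, .refl, .refl, fun _ => rfl⟩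
    | @tail v u _ hstep ih =>
      obtain ⟨w, hw, hsw, hwv, _⟩ := ih
      by_cases hu : u ∈ W
      · exact ⟨u, hu, hsw.tail ⟨⟨hw, hu, v, hwv, hstep.1⟩,
          fun hx => hstep.2 (Finset.mem_inter.2 ⟨hx, hu⟩)⟩, .refl, fun _ => rfl⟩
      · exact ⟨w, hw, hsw, hwv.tail ⟨hstep.1, hu⟩, fun hu' => absurd hu' hu⟩
  obtain ⟨w, _, hsw, _, hwb⟩ := key
  exact h b hb ⟨s, hs, hsX', hwb (hB hb) ▸ hsw⟩

/-- every digraph `G` with a nonempty terminal set `T` admits a digraph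
`G'` with `T ⊆ V(G') ⊆ V(G)` and `|V(G')| ≤ |T| + |T|·2^{|T|}` such that for every
partition `(A,B)` of `T` the minimum `A`-`B` separator sizes in `G` and `G'` agree
(in particular, `G'` is a `(|T|,T)` vertex cut sparsifier of `G`). -/
theorem closure_vertex_cut_sparsifier
    (V : Type*) [Fintype V] [DecidableEq V] (E : V → V → Prop)
    (T : Finset V) (hT : T.Nonempty) :
    ∃ (W : Finset V) (E' : V → V → Prop),
      T ⊆ W ∧ (∀ x y : V, E' x y → x ∈ W ∧ y ∈ W) ∧
      W.card ≤ T.card + T.card * 2 ^ T.card ∧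
      ∀ A B : Finset V, A ∪ B = T → Disjoint A B →
        minSepSize E' A B = minSepSize E A B := by
  classical
  choose X hX hXcard using fun A : Finset V => exists_isSep_card_eq_minSepSize E A (T \ A)
  set W := T ∪ T.powerset.biUnion X
  have hTW : T ⊆ W := Finset.subset_union_left
  refine ⟨W, closureArcs E W, hTW, fun x y hxy => ⟨hxy.1, hxy.2.1⟩, ?_, ?_⟩
  · have hcard : (T.powerset.biUnion X).card ≤ T.powerset.card * T.card :=
      Finset.card_biUnion_le_card_mul _ _ _ fun A hA =>
        (hXcard A).trans_le ((minSepSize_le (isSep_left E A _)).trans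
          (Finset.card_le_card (Finset.mem_powerset.1 hA)))
    rw [Finset.card_powerset, mul_comm] at hcard
    exact (Finset.card_union_le _ _).trans (Nat.add_le_add_left hcard _)
  · intro A B hAB hdisj
    have hAT : A ⊆ T := hAB ▸ Finset.subset_union_left
    have hBT : B ⊆ T := hAB ▸ Finset.subset_union_right
    have hB : T \ A = B := by
      rw [← hAB, Finset.union_sdiff_left, hdisj.symm.sdiff_eq_left]
    have hXA := hX A
    have hXAcard := hXcard A
    rw [hB] at hXA hXAcard
    have hXW : X A ⊆ W :=
      (Finset.subset_biUnion_of_mem X (Finset.mem_powerset.2 hAT)).trans Finset.subset_union_right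
    apply le_antisymm
    · exact hXAcard ▸ minSepSize_le (hXA.closureArcs hXW)
    · obtain ⟨Y, hY, hYcard⟩ := exists_isSep_card_eq_minSepSize (closureArcs E W) A B
      rw [← hYcard]
      exact (minSepSize_le (hY.of_closureArcs (hAT.trans hTW) (hBT.trans hTW))).trans
        (Finset.card_le_card Finset.inter_subset_left)
end
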